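/- Fix a real number ξ. Then, as n → ∞ through the natural numbers, H_n(ξ) · e^{-ξ²/2} · e^{n/2} · (2n)^{-n/2} / √2 - cos(nπ/2 - ξ√(2n)) → 0, where H_n is the (physicists') Hermite polynomial. Equivalently, H_n(ξ) = √2 · exp((n/2)(ln(2n) - 1) + ξ²/2) · (cos(nπ/2 - ξ√(2n)) + o(1)) as n → ∞. -/

import Mathlib

open Real in
/-- The (physicists') Hermite polynomial
`H_n(x) = n! Σ_{k=0}^{⌊n/2⌋} (-1)^k / (k!(n-2k)!) (2x)^{n-2k}`. -/
noncomputable def hermite (n : ℕ) (x : ℝ) : ℝ :=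
  (n.factorial : ℝ) * ∑ k ∈ Finset.range (n / 2 + 1),
    (-1 : ℝ) ^ k / ((k.factorial : ℝ) * ((n - 2 * k).factorial : ℝ)) * (2 * x) ^ (n - 2 * k)

theorem sum_range_half_succ {M : Type*} [AddCommMonoid M] (f : ℕ → M) (n : ℕ)
    (hf : ∀ k, 2 * k = n + 1 → f k = 0) :
    ∑ k ∈ Finset.range ((n + 1) / 2 + 1), f k = ∑ k ∈ Finset.range (n / 2 + 1), f k := by
  rcases Nat.even_or_odd' n with ⟨m, rfl | rfl⟩
  · congr 2
    omega
  · rw [show (2 * m + 1 + 1) / 2 = (2 * m + 1) / 2 + 1 by omega, Finset.sum_range_succ _ (_ + 1),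
      hf _ (by omega), add_zero]

theorem hermite_zero (x : ℝ) : hermite 0 x = 1 := by simp [hermite]

theorem hermite_one (x : ℝ) : hermite 1 x = 2 * x := by simp [hermite]

theorem hermite_add_two (n : ℕ) (x : ℝ) :
    hermite (n + 2) x = 2 * x * hermite (n + 1) x - 2 * (n + 1) * hermite n x := by
  have h1 : ∑ k ∈ Finset.range ((n + 2) / 2 + 1), ((n + 2 - 2 * k : ℕ) : ℝ) *
      ((-1 : ℝ) ^ k / ((k.factorial : ℝ) * ((n + 2 - 2 * k).factorial : ℝ)) *
        (2 * x) ^ (n + 2 - 2 * k)) =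
      2 * x * ∑ k ∈ Finset.range ((n + 1) / 2 + 1),
        (-1 : ℝ) ^ k / ((k.factorial : ℝ) * ((n + 1 - 2 * k).factorial : ℝ)) *
          (2 * x) ^ (n + 1 - 2 * k) := by
    rw [sum_range_half_succ _ (n + 1), Finset.mul_sum]
    · refine Finset.sum_congr rfl fun k hk => ?_
      rw [Finset.mem_range] at hk
      rw [show n + 2 - 2 * k = (n + 1 - 2 * k) + 1 by omega, Nat.factorial_succ]
      push_cast
      field_simp
      ring
    · intro k hk
      rw [show n + 2 - 2 * k = 0 by omega]
      simp
  have h2 : ∑ k ∈ Finset.range ((n + 2) / 2 + 1), (2 * k : ℝ) *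
      ((-1 : ℝ) ^ k / ((k.factorial : ℝ) * ((n + 2 - 2 * k).factorial : ℝ)) *
        (2 * x) ^ (n + 2 - 2 * k)) =
      -2 * ∑ k ∈ Finset.range (n / 2 + 1),
        (-1 : ℝ) ^ k / ((k.factorial : ℝ) * ((n - 2 * k).factorial : ℝ)) *
          (2 * x) ^ (n - 2 * k) := by
    rw [show (n + 2) / 2 + 1 = (n / 2 + 1) + 1 by omega, Finset.sum_range_succ', Finset.mul_sum]
    simp only [Nat.cast_zero, mul_zero, zero_mul, add_zero]
    refine Finset.sum_congr rfl fun k _ => ?_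
    rw [show n + 2 - 2 * (k + 1) = n - 2 * k by omega, Nat.factorial_succ]
    push_cast
    field_simp
    ring
  have h3 : (n + 2 : ℝ) * ∑ k ∈ Finset.range ((n + 2) / 2 + 1),
      (-1 : ℝ) ^ k / ((k.factorial : ℝ) * ((n + 2 - 2 * k).factorial : ℝ)) *
        (2 * x) ^ (n + 2 - 2 * k) =
      2 * x * (∑ k ∈ Finset.range ((n + 1) / 2 + 1),
        (-1 : ℝ) ^ k / ((k.factorial : ℝ) * ((n + 1 - 2 * k).factorial : ℝ)) *
          (2 * x) ^ (n + 1 - 2 * k)) +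
      -2 * ∑ k ∈ Finset.range (n / 2 + 1),
        (-1 : ℝ) ^ k / ((k.factorial : ℝ) * ((n - 2 * k).factorial : ℝ)) *
          (2 * x) ^ (n - 2 * k) := by
    rw [← h1, ← h2, Finset.mul_sum, ← Finset.sum_add_distrib]
    refine Finset.sum_congr rfl fun k hk => ?_
    rw [Finset.mem_range] at hk
    rw [← add_mul, Nat.cast_sub (by omega)]
    push_cast
    ring
  simp only [hermite, Nat.factorial_succ, Nat.cast_mul]
  push_cast
  linear_combination ((n : ℝ) + 1) * n.factorial * h3

theorem hasDerivAt_hermite (n : ℕ) (x : ℝ) :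
    HasDerivAt (hermite n) (2 * n * hermite (n - 1) x) x := by
  cases n with
  | zero =>
    have h : hermite 0 = fun _ => 1 := funext hermite_zero
    simpa [h] using hasDerivAt_const x (1 : ℝ)
  | succ n =>
    have h : HasDerivAt (fun y => hermite (n + 1) y) (((n + 1).factorial : ℝ) *
        ∑ k ∈ Finset.range ((n + 1) / 2 + 1),
          (-1 : ℝ) ^ k / ((k.factorial : ℝ) * ((n + 1 - 2 * k).factorial : ℝ)) *
            (((n + 1 - 2 * k : ℕ) : ℝ) * (2 * x) ^ (n + 1 - 2 * k - 1) * (2 * 1))) x := by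
      unfold hermite
      exact (HasDerivAt.fun_sum fun k _ =>
        (((hasDerivAt_id x).const_mul 2).pow _).const_mul _).const_mul _
    refine h.congr_deriv ?_
    rw [sum_range_half_succ]
    · simp only [hermite, Nat.add_sub_cancel, Nat.factorial_succ, Finset.mul_sum]
      refine Finset.sum_congr rfl fun k hk => ?_
      rw [Finset.mem_range] at hk
      rw [show n + 1 - 2 * k = (n - 2 * k) + 1 by omega, Nat.factorial_succ]
      push_cast
      field_simp
    · intro k hk
      rw [show n + 1 - 2 * k = 0 by omega]
      simp

theorem hermite_even_apply_zero (m : ℕ) :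
    hermite (2 * m) 0 = (-1) ^ m * ((2 * m).factorial / m.factorial) := by
  induction m with
  | zero => simp [hermite_zero]
  | succ m ih =>
    rw [show 2 * (m + 1) = 2 * m + 2 by ring, hermite_add_two, ih]
    simp only [Nat.factorial_succ]
    push_cast
    field_simp
    ring

theorem hermite_odd_apply_zero (m : ℕ) : hermite (2 * m + 1) 0 = 0 := by
  induction m with
  | zero => simp [hermite_one]
  | succ m ih =>
    rw [show 2 * (m + 1) + 1 = 2 * m + 1 + 2 by ring, hermite_add_two, ih]
    simp

/-- The derivative of the Hermite function `hermite n x * exp (-x ^ 2 / 2)`. -/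
theorem hasDerivAt_hermite_mul_exp (n : ℕ) (x : ℝ) :
    HasDerivAt (fun x => hermite n x * Real.exp (-x ^ 2 / 2))
      ((2 * n * hermite (n - 1) x - x * hermite n x) * Real.exp (-x ^ 2 / 2)) x := by
  have he : HasDerivAt (fun x : ℝ => Real.exp (-x ^ 2 / 2)) _ x :=
    (((hasDerivAt_pow 2 x).neg).div_const 2).exp
  refine ((hasDerivAt_hermite n x).mul he).congr_deriv ?_
  simp
  ring

/-- The Hermite function satisfies `u'' = (x ^ 2 - 1 - 2 * n) * u`. -/
theorem hasDerivAt_deriv_hermite_mul_exp {n : ℕ} (hn : n ≠ 0) (x : ℝ) :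
    HasDerivAt (fun x => (2 * n * hermite (n - 1) x - x * hermite n x) * Real.exp (-x ^ 2 / 2))
      ((x ^ 2 - 1 - 2 * n) * (hermite n x * Real.exp (-x ^ 2 / 2))) x := by
  have he : HasDerivAt (fun x : ℝ => Real.exp (-x ^ 2 / 2)) _ x :=
    (((hasDerivAt_pow 2 x).neg).div_const 2).exp
  refine ((((hasDerivAt_hermite (n - 1) x).const_mul (2 * (n : ℝ))).sub
    ((hasDerivAt_id x).mul (hasDerivAt_hermite n x))).mul he).congr_deriv ?_
  obtain ⟨n, rfl⟩ := Nat.exists_eq_succ_of_ne_zero hn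
  rcases n with _ | n
  · simp [hermite_zero, hermite_one]
    ring
  · simp [hermite_add_two]
    ring

/-- Solutions of `u'' + ω² u = (x² - 1) u` are close to solutions of the harmonic oscillator: in the
rotating frame `(u + i u' / ω) exp (i ω x)` moves little. -/
theorem norm_rotating_sub_le {u v : ℝ → ℝ} {ω : ℝ} (hω : 0 < ω)
    (hu : ∀ x, HasDerivAt u (v x) x)
    (hv : ∀ x, HasDerivAt v ((x ^ 2 - 1 - ω ^ 2) * u x) x) (ξ : ℝ) :
    ‖((u ξ : ℂ) + v ξ / ω * Complex.I) * Complex.exp (ω * ξ * Complex.I) -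
        ((u 0 : ℂ) + v 0 / ω * Complex.I)‖ ≤
      ‖(u 0 : ℂ) + v 0 / ω * Complex.I‖ * (Real.exp (|ξ| * (ξ ^ 2 + 1) / ω) - 1) := by
  set z : ℝ → ℂ := fun x => ((u x : ℂ) + v x / ω * Complex.I) * Complex.exp (ω * x * Complex.I)
    with hz
  have hω' : (ω : ℂ) ≠ 0 := by exact_mod_cast hω.ne'
  have hnorm : ∀ x : ℝ, ‖Complex.exp (ω * x * Complex.I)‖ = 1 := fun x => by
    simpa using Complex.norm_exp_ofReal_mul_I (ω * x)
  have hz0 : z 0 = (u 0 : ℂ) + v 0 / ω * Complex.I := by simp [hz]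
  have hz' : ∀ x, HasDerivAt z
      (((x ^ 2 - 1) * u x / ω : ℝ) * Complex.I * Complex.exp (ω * x * Complex.I)) x := by
    intro x
    have he : HasDerivAt (fun x : ℝ => Complex.exp (ω * x * Complex.I)) _ x :=
      (((hasDerivAt_id x).ofReal_comp.const_mul (ω : ℂ)).mul_const Complex.I).cexp
    refine (((hu x).ofReal_comp.add (((hv x).ofReal_comp.div_const (ω : ℂ)).mul_const
      Complex.I)).mul he).congr_deriv ?_
    simp
    field_simp
    ring_nf
    simp [Complex.I_sq]
  have hu_le : ∀ x, |u x| ≤ ‖z x‖ := fun x => by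
    rw [hz]
    simp only [norm_mul, hnorm, mul_one]
    refine le_trans (le_of_eq ?_) (Complex.abs_re_le_norm _)
    congr 1
    rw [← Complex.ofReal_div]
    simp
  have hcomp : ∀ t : ℝ, HasDerivAt (fun t : ℝ => z (t * ξ) - z 0) (ξ • ((((t * ξ) ^ 2 - 1) *
      u (t * ξ) / ω : ℝ) * Complex.I * Complex.exp (ω * (t * ξ : ℝ) * Complex.I))) t := by
    intro t
    have h1 : HasDerivAt (fun t : ℝ => t * ξ) ξ t := by
      simpa using (hasDerivAt_id t).mul_const ξ
    exact ((hz' (t * ξ)).scomp t h1).sub_const _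
  set K := |ξ| * (ξ ^ 2 + 1) / ω with hK
  have hK0 : 0 ≤ K := by positivity
  have key := norm_le_gronwallBound_of_norm_deriv_right_le (f := fun t : ℝ => z (t * ξ) - z 0)
    (δ := 0) (K := K) (ε := K * ‖z 0‖) (a := 0) (b := 1)
    (fun t _ => (hcomp t).continuousAt.continuousWithinAt)
    (fun t _ => (hcomp t).hasDerivWithinAt) (by simp) (by
      intro t ht
      have ht2 : |(t * ξ) ^ 2 - 1| ≤ ξ ^ 2 + 1 := by
        have h1 : t ^ 2 ≤ 1 := by nlinarith [ht.1, ht.2]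
        have h2 : (t * ξ) ^ 2 ≤ ξ ^ 2 := by
          rw [mul_pow]; nlinarith [sq_nonneg ξ]
        rw [abs_le]
        constructor <;> nlinarith [sq_nonneg (t * ξ), sq_nonneg ξ]
      have h3 : ‖z (t * ξ)‖ ≤ ‖z (t * ξ) - z 0‖ + ‖z 0‖ := by
        simpa using norm_add_le (z (t * ξ) - z 0) (z 0)
      rw [norm_smul, norm_mul, norm_mul, hnorm, Complex.norm_real, Complex.norm_I, mul_one, mul_one,
        Real.norm_eq_abs, Real.norm_eq_abs, abs_div, abs_mul, abs_of_pos hω, ← mul_add]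
      calc |ξ| * (|(t * ξ) ^ 2 - 1| * |u (t * ξ)| / ω)
          ≤ |ξ| * ((ξ ^ 2 + 1) * (‖z (t * ξ) - z 0‖ + ‖z 0‖) / ω) := by
            gcongr
            exact (hu_le _).trans h3
        _ = K * (‖z (t * ξ) - z 0‖ + ‖z 0‖) := by rw [hK]; ring)
    1 (by simp)
  rw [← hz0]
  simp only [one_mul, sub_zero] at key
  refine key.trans (le_of_eq ?_)
  rcases eq_or_ne K 0 with h | h
  · simp [h, gronwallBound_K0]
  · rw [gronwallBound_of_K_ne_0 h]
    field_simp
    simp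

/-- Stirling's formula for the quotient: `(2m)! / m! ~ √2 (4m / e) ^ m`. -/
theorem tendsto_factorial_two_mul_div_factorial :
    Filter.Tendsto (fun m : ℕ => Real.exp m / ((4 * m) ^ m * Real.sqrt 2) *
      ((2 * m).factorial / m.factorial)) Filter.atTop (nhds 1) := by
  have hS := Stirling.tendsto_stirlingSeq_sqrt_pi
  have h2 : Filter.Tendsto (fun m : ℕ => 2 * m) Filter.atTop Filter.atTop :=
    Filter.tendsto_id.const_mul_atTop' two_pos
  have hπ : √Real.pi ≠ 0 := by positivity
  have h := (hS.comp h2).div hS hπ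
  rw [div_self hπ] at h
  refine h.congr' ?_
  filter_upwards [Filter.eventually_gt_atTop 0] with m hm
  have hm' : (0 : ℝ) < m := by exact_mod_cast hm
  simp only [Function.comp, Pi.div_apply, Stirling.stirlingSeq]
  have e1 : Real.exp m = Real.exp 1 ^ m := by rw [← Real.exp_nat_mul, mul_one]
  have e2 : √(2 * ((2 * m : ℕ) : ℝ)) = √2 * √(2 * m) := by
    rw [← Real.sqrt_mul (by norm_num)]
    push_cast
    rfl
  rw [e1, e2]
  push_cast
  rw [pow_mul, div_pow (2 * (m : ℝ)), mul_pow 2 (m : ℝ) 2, div_pow, div_pow, mul_pow (4 : ℝ),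
    mul_pow]
  field_simp
  ring_nf

/-- The normalising factor in the asymptotics of `hermite n`. -/
noncomputable def hermiteScale (n : ℕ) : ℝ :=
  Real.exp ((n : ℝ) / 2) * (2 * (n : ℝ)) ^ (-(n : ℝ) / 2) / Real.sqrt 2

theorem hermiteScale_nonneg (n : ℕ) : 0 ≤ hermiteScale n := by
  unfold hermiteScale
  positivity

theorem tendsto_hermiteScale_even :
    Filter.Tendsto (fun m : ℕ => hermiteScale (2 * m) * ((2 * m).factorial / m.factorial))
      Filter.atTop (nhds 1) := by
  refine tendsto_factorial_two_mul_div_factorial.congr fun m => ?_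
  unfold hermiteScale
  congr 1
  rw [show ((2 * m : ℕ) : ℝ) / 2 = m by push_cast; ring,
    show -((2 * m : ℕ) : ℝ) / 2 = -(m : ℝ) by push_cast; ring,
    show (2 * ((2 * m : ℕ) : ℝ)) = 4 * m by push_cast; ring,
    Real.rpow_neg (by positivity), Real.rpow_natCast]
  field_simp

theorem tendsto_hermiteScale_odd :
    Filter.Tendsto (fun m : ℕ => hermiteScale (2 * m + 1) * √(2 * (2 * m + 1 : ℕ)) *
      ((2 * m).factorial / m.factorial)) Filter.atTop (nhds 1) := by
  have h1 := ((Real.tendsto_one_add_div_pow_exp (1 / 2)).inv₀ (Real.exp_pos _).ne').const_mul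
    (Real.exp (1 / 2))
  rw [mul_inv_cancel₀ (Real.exp_pos _).ne'] at h1
  have h := h1.mul tendsto_factorial_two_mul_div_factorial
  rw [one_mul] at h
  refine h.congr' ?_
  filter_upwards [Filter.eventually_gt_atTop 0] with m hm
  have hm' : (0 : ℝ) < m := by exact_mod_cast hm
  unfold hermiteScale
  rw [← mul_assoc]
  congr 1
  have hpos : (0 : ℝ) < 2 * (2 * m + 1 : ℕ) := by positivity
  have e1 : ((2 : ℝ) * (2 * m + 1 : ℕ)) ^ (-((2 * m + 1 : ℕ) : ℝ) / 2) * √(2 * (2 * m + 1 : ℕ)) =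
      ((2 * (2 * m + 1 : ℕ) : ℝ) ^ m)⁻¹ := by
    rw [Real.sqrt_eq_rpow, ← Real.rpow_add hpos, ← Real.rpow_natCast, ← Real.rpow_neg hpos.le]
    congr 1
    push_cast
    ring
  have e2 : Real.exp (((2 * m + 1 : ℕ) : ℝ) / 2) = Real.exp (1 / 2) * Real.exp m := by
    rw [← Real.exp_add]
    congr 1
    push_cast
    ring
  have e3 : (1 + 1 / 2 / (m : ℝ)) ^ m * (4 * m) ^ m = (2 * (2 * m + 1 : ℕ)) ^ m := by
    rw [← mul_pow]
    congr 1
    push_cast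
    field_simp
    ring
  rw [div_mul_eq_mul_div, mul_assoc (Real.exp (((2 * m + 1 : ℕ) : ℝ) / 2)), e1, e2, ← e3]
  field_simp

theorem tendsto_of_even_of_odd {α : Type*} {f : ℕ → α} {l : Filter α}
    (he : Filter.Tendsto (fun m => f (2 * m)) Filter.atTop l)
    (ho : Filter.Tendsto (fun m => f (2 * m + 1)) Filter.atTop l) :
    Filter.Tendsto f Filter.atTop l := by
  intro s hs
  obtain ⟨a, ha⟩ := Filter.mem_atTop_sets.1 (he hs)
  obtain ⟨b, hb⟩ := Filter.mem_atTop_sets.1 (ho hs)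
  refine Filter.mem_atTop_sets.2 ⟨2 * a + 2 * b + 1, fun n hn => ?_⟩
  rcases Nat.even_or_odd' n with ⟨m, rfl | rfl⟩
  · exact ha m (by omega)
  · exact hb m (by omega)

theorem tendsto_hermiteScale_mul_initial_sub :
    Filter.Tendsto (fun n : ℕ => (hermiteScale n : ℂ) *
      ((hermite n 0 : ℂ) + (2 * n * hermite (n - 1) 0 : ℝ) / (√(2 * n) : ℝ) * Complex.I) -
        Complex.I ^ n) Filter.atTop (nhds 0) := by
  have norm_eq_norm_mul {c : ℂ} (hc : ‖c‖ = 1) (w : ℂ) : ‖w‖ = ‖c * w‖ := by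
    rw [norm_mul, hc, one_mul]
  apply tendsto_of_even_of_odd
  · rw [tendsto_zero_iff_norm_tendsto_zero]
    have h := (tendsto_hermiteScale_even.sub_const 1).norm
    rw [sub_self, norm_zero] at h
    refine h.congr fun m => ?_
    have h0 : ((2 * (2 * m : ℕ) : ℝ)) * hermite (2 * m - 1) 0 = 0 := by
      rcases m with _ | m
      · simp
      · rw [show 2 * (m + 1) - 1 = 2 * m + 1 by omega, hermite_odd_apply_zero, mul_zero]
    rw [h0, hermite_even_apply_zero, pow_mul, Complex.I_sq, ← Complex.norm_real]
    have : ‖((-1 : ℂ) ^ m)‖ = 1 := by simp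
    refine (norm_eq_norm_mul this _).trans ?_
    congr 1
    push_cast
    ring
  · rw [tendsto_zero_iff_norm_tendsto_zero]
    have h := (tendsto_hermiteScale_odd.sub_const 1).norm
    rw [sub_self, norm_zero] at h
    refine h.congr fun m => ?_
    have h0 : (2 * ((2 * m + 1 : ℕ) : ℝ)) = √(2 * (2 * m + 1 : ℕ)) * √(2 * (2 * m + 1 : ℕ)) :=
      (Real.mul_self_sqrt (by positivity)).symm
    have hs : √(2 * ((2 * m + 1 : ℕ) : ℝ)) ≠ 0 := by positivity
    rw [hermite_odd_apply_zero, Nat.add_sub_cancel, hermite_even_apply_zero, pow_succ, pow_mul,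
      Complex.I_sq, ← Complex.norm_real, ← Complex.ofReal_div]
    have e : 2 * ((2 * m + 1 : ℕ) : ℝ) * ((-1) ^ m * ((2 * m).factorial / m.factorial)) /
        √(2 * (2 * m + 1 : ℕ)) =
        √(2 * (2 * m + 1 : ℕ)) * ((-1) ^ m * ((2 * m).factorial / m.factorial)) := by
      rw [div_eq_iff hs]
      linear_combination ((-1) ^ m * ((2 * m).factorial / m.factorial : ℝ)) * h0
    rw [e]
    have : ‖((-1 : ℂ) ^ m * Complex.I)‖ = 1 := by simp
    refine (norm_eq_norm_mul this _).trans ?_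
    congr 1
    push_cast
    ring

open Real in
/-- The leading-order oscillatory asymptotics of the Hermite polynomial at fixed
real argument `ξ`:
`H_n(ξ) e^{-ξ²/2} e^{n/2} (2n)^{-n/2} / √2 - cos(nπ/2 - ξ√(2n)) → 0` as `n → ∞`,
i.e. `H_n(ξ) = √2 exp((n/2)(ln(2n) - 1) + ξ²/2)(cos(nπ/2 - ξ√(2n)) + o(1))`. -/
theorem hermite_fixed_argument_asymptotics (ξ : ℝ) :
    Filter.Tendsto
      (fun n : ℕ =>
        hermite n ξ * Real.exp (-ξ ^ 2 / 2) * Real.exp ((n : ℝ) / 2) *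
            (2 * (n : ℝ)) ^ (-(n : ℝ) / 2) / Real.sqrt 2 -
          Real.cos ((n : ℝ) * π / 2 - ξ * Real.sqrt (2 * n)))
      Filter.atTop (nhds 0) := by
  set w : ℕ → ℂ := fun n => (hermite n 0 : ℂ) +
    (2 * n * hermite (n - 1) 0 : ℝ) / (√(2 * n) : ℝ) * Complex.I with hw
  have hinit : Filter.Tendsto (fun n => hermiteScale n * w n - Complex.I ^ n) Filter.atTop
      (nhds 0) := tendsto_hermiteScale_mul_initial_sub
  have hgrow : Filter.Tendsto (fun n : ℕ => Real.exp (|ξ| * (ξ ^ 2 + 1) / √(2 * n)) - 1)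
      Filter.atTop (nhds 0) := by
    have h1 : Filter.Tendsto (fun n : ℕ => √(2 * n)) Filter.atTop Filter.atTop :=
      Real.tendsto_sqrt_atTop.comp (tendsto_natCast_atTop_atTop.const_mul_atTop two_pos)
    simpa using
      ((Real.continuous_exp.tendsto 0).comp (h1.const_div_atTop (|ξ| * (ξ ^ 2 + 1)))).sub_const 1
  have hbound : Filter.Tendsto (fun n : ℕ =>
      (1 + ‖hermiteScale n * w n - Complex.I ^ n‖) *
        (Real.exp (|ξ| * (ξ ^ 2 + 1) / √(2 * n)) - 1) +
      ‖hermiteScale n * w n - Complex.I ^ n‖) Filter.atTop (nhds 0) := by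
    simpa using ((hinit.norm.const_add 1).mul hgrow).add hinit.norm
  refine squeeze_zero_norm' ?_ hbound
  filter_upwards [Filter.eventually_gt_atTop 0] with n hn
  have hn' : (0 : ℝ) < n := by exact_mod_cast hn
  have hω : 0 < √(2 * (n : ℝ)) := by positivity
  have key := norm_rotating_sub_le hω (hasDerivAt_hermite_mul_exp n) (fun x => by
    rw [Real.sq_sqrt (by positivity)]
    exact hasDerivAt_deriv_hermite_mul_exp hn.ne' x) ξ
  set u := hermite n ξ * Real.exp (-ξ ^ 2 / 2) with hu
  set v := (2 * n * hermite (n - 1) ξ - ξ * hermite n ξ) * Real.exp (-ξ ^ 2 / 2)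
  set ω := √(2 * (n : ℝ))
  have hw0 : ((hermite n 0 * Real.exp (-0 ^ 2 / 2) : ℝ) : ℂ) +
      ((2 * n * hermite (n - 1) 0 - 0 * hermite n 0) * Real.exp (-0 ^ 2 / 2) : ℝ) / (ω : ℂ) *
        Complex.I = w n := by
    simp [hw, ω]
  rw [hw0] at key
  set z : ℂ := ((u : ℂ) + v / ω * Complex.I) * Complex.exp (ω * ξ * Complex.I)
  have hphase : Complex.I ^ n = Complex.exp (((n : ℝ) * π / 2 : ℝ) * Complex.I) := by
    conv_lhs => rw [← Complex.exp_pi_div_two_mul_I, ← Complex.exp_nat_mul]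
    congr 1
    push_cast
    ring
  have hre : hermite n ξ * Real.exp (-ξ ^ 2 / 2) * Real.exp ((n : ℝ) / 2) *
      (2 * (n : ℝ)) ^ (-(n : ℝ) / 2) / Real.sqrt 2 - Real.cos ((n : ℝ) * π / 2 - ξ * ω) =
      ((hermiteScale n * z - Complex.I ^ n) * Complex.exp ((-(ω * ξ) : ℝ) * Complex.I)).re := by
    have e1 : (hermiteScale n * z - Complex.I ^ n) * Complex.exp ((-(ω * ξ) : ℝ) * Complex.I) =
        hermiteScale n * ((u : ℂ) + (v / ω : ℝ) * Complex.I) -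
          Complex.exp (((n : ℝ) * π / 2 - ξ * ω : ℝ) * Complex.I) := by
      rw [sub_mul, hphase, ← Complex.exp_add, mul_assoc (hermiteScale n : ℂ), mul_assoc,
        ← Complex.exp_add]
      congr 2
      · have : (ω * ξ * Complex.I + (-(ω * ξ) : ℝ) * Complex.I : ℂ) = 0 := by
          push_cast
          ring
        rw [this, Complex.exp_zero, mul_one, Complex.ofReal_div]
      · push_cast
        ring
    rw [e1, Complex.sub_re, Complex.exp_ofReal_mul_I_re, Complex.re_ofReal_mul]
    simp only [Complex.add_re, Complex.ofReal_re, Complex.re_ofReal_mul, Complex.I_re, mul_zero,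
      add_zero]
    rw [hu, hermiteScale]
    ring
  rw [hre]
  refine (Complex.abs_re_le_norm _).trans ?_
  rw [norm_mul, Complex.norm_exp_ofReal_mul_I, mul_one]
  have hE : 0 ≤ Real.exp (|ξ| * (ξ ^ 2 + 1) / ω) - 1 :=
    sub_nonneg.2 (Real.one_le_exp (by positivity))
  have hwn : hermiteScale n * ‖w n‖ ≤ 1 + ‖hermiteScale n * w n - Complex.I ^ n‖ := by
    have h := norm_add_le (Complex.I ^ n) (hermiteScale n * w n - Complex.I ^ n)
    simpa [abs_of_nonneg (hermiteScale_nonneg n)] using h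
  calc ‖hermiteScale n * z - Complex.I ^ n‖
      = ‖hermiteScale n * (z - w n) + (hermiteScale n * w n - Complex.I ^ n)‖ := by
        congr 1
        ring
    _ ≤ hermiteScale n * ‖z - w n‖ + ‖hermiteScale n * w n - Complex.I ^ n‖ := by
        refine (norm_add_le _ _).trans (le_of_eq ?_)
        rw [norm_mul, Complex.norm_real, Real.norm_of_nonneg (hermiteScale_nonneg n)]
    _ ≤ hermiteScale n * (‖w n‖ * (Real.exp (|ξ| * (ξ ^ 2 + 1) / ω) - 1)) +
          ‖hermiteScale n * w n - Complex.I ^ n‖ := by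
        gcongr
        exact hermiteScale_nonneg n
    _ ≤ _ := by
        rw [← mul_assoc]
        gcongr
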